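/- arXiv:math/0205033 — 2 statements merged into one kernel-verified Lean document; each statement's English description precedes it below -/
import Mathlib

section
/- Let (ξ_j)_{j≥1} be a sequence of real-valued random variables on a probability space such that E(ξ_{j+1} | σ(ξ_1, …, ξ_j)) ≤ 0 almost surely for every j ≥ 1, and such that for every positive integer N the sequence (E|ξ_j|^N)_j is bounded. Then for every ε > 0 and every positive integer N there exists a constant κ = κ(ε, N) > 0 such that for every n ≥ 1, P(ξ_1 + ξ_2 + ⋯ + ξ_n ≥ ε n) ≤ κ n^{-N}. -/
open MeasureTheory Finset
open scoped ENNReal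

lemma aux_mid (t y : ℝ) (ht : 0 ≤ t) (hy : 0 ≤ y) (r j : ℕ) (hj : j ≤ r) :
    y ^ (j + 2) * t ^ (r - j) ≤ t ^ r * y ^ 2 + y ^ (r + 2) := by
  obtain ⟨d, rfl⟩ := Nat.exists_eq_add_of_le hj
  have e : j + d - j = d := by omega
  rw [e]
  rcases le_total y t with h | h
  · have h1 : y ^ j ≤ t ^ j := pow_le_pow_left₀ hy h j
    have h2 : 0 ≤ y ^ (j + d + 2) := by positivity
    have h3 : y ^ j * (y ^ 2 * t ^ d) ≤ t ^ j * (y ^ 2 * t ^ d) :=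
      mul_le_mul_of_nonneg_right h1 (by positivity)
    calc y ^ (j + 2) * t ^ d = y ^ j * (y ^ 2 * t ^ d) := by ring
      _ ≤ t ^ j * (y ^ 2 * t ^ d) := h3
      _ = t ^ (j + d) * y ^ 2 := by ring
      _ ≤ _ := by linarith
  · have h1 : t ^ d ≤ y ^ d := pow_le_pow_left₀ ht h d
    have h2 : 0 ≤ t ^ (j + d) * y ^ 2 := by positivity
    calc y ^ (j + 2) * t ^ d ≤ y ^ (j + 2) * y ^ d :=
          mul_le_mul_of_nonneg_left h1 (by positivity)
      _ = y ^ (j + d + 2) := by ring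
      _ ≤ _ := by linarith

lemma aux_binom (t x : ℝ) (ht : 0 ≤ t) (r : ℕ) :
    (t + x) ^ (r + 2) ≤ t ^ (r + 2) + (r + 2) * (t ^ (r + 1) * x)
      + 2 ^ (r + 2) * (t ^ r * |x| ^ 2 + |x| ^ (r + 2)) := by
  rw [add_comm t x, add_pow, Finset.sum_range_succ', Finset.sum_range_succ']
  have hs : ∑ k ∈ range (r + 1), x ^ (k + 1 + 1) * t ^ (r + 2 - (k + 1 + 1))
      * ((r + 2).choose (k + 1 + 1) : ℝ)
      ≤ ∑ k ∈ range (r + 1), (t ^ r * |x| ^ 2 + |x| ^ (r + 2)) * ((r + 2).choose (k + 1 + 1) : ℝ) := by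
    refine Finset.sum_le_sum fun k hk => ?_
    refine mul_le_mul_of_nonneg_right ?_ (by positivity)
    have hk' : k ≤ r := by simpa [Nat.lt_succ_iff] using hk
    have e : r + 2 - (k + 1 + 1) = r - k := by omega
    rw [e]
    refine le_trans ?_ (aux_mid t |x| ht (abs_nonneg x) r k hk')
    refine mul_le_mul_of_nonneg_right ?_ (by positivity)
    rw [← abs_pow]
    exact le_abs_self _
  have hc : ∑ k ∈ range (r + 1), ((r + 2).choose (k + 1 + 1) : ℝ) ≤ 2 ^ (r + 2) := by
    have := Nat.sum_range_choose (r + 2)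
    rw [Finset.sum_range_succ', Finset.sum_range_succ'] at this
    have h2 : ∑ k ∈ range (r + 1), ((r + 2).choose (k + 1 + 1)) ≤ 2 ^ (r + 2) := by omega
    exact_mod_cast h2
  rw [← Finset.mul_sum] at hs
  have h3 := mul_le_mul_of_nonneg_left hc
    (show 0 ≤ t ^ r * |x| ^ 2 + |x| ^ (r + 2) by positivity)
  have e1 : r + 2 - (0 + 1) = r + 1 := by omega
  simp only [e1, zero_add, pow_one, pow_zero, Nat.choose_one_right, Nat.choose_zero_right,
    Nat.sub_zero, one_mul, Nat.cast_one, mul_one, Nat.cast_add, Nat.cast_ofNat]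
  linarith

lemma aux_young (t y m : ℝ) (ht : 0 ≤ t) (hm : 1 ≤ m) (p : ℕ) :
    t ^ (2 * p) * y ^ 2 ≤ t ^ (2 * p + 2) / m + m ^ p * y ^ (2 * p + 2) := by
  have hm0 : 0 < m := by linarith
  have hy2 : 0 ≤ y ^ (2 * p + 2) := by
    rw [show 2 * p + 2 = 2 * (p + 1) by ring, pow_mul]; positivity
  rcases le_total (m * y ^ 2) (t ^ 2) with h | h
  · have : t ^ (2 * p) * y ^ 2 ≤ t ^ (2 * p + 2) / m := by
      rw [le_div_iff₀ hm0]
      calc t ^ (2 * p) * y ^ 2 * m = t ^ (2 * p) * (m * y ^ 2) := by ring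
        _ ≤ t ^ (2 * p) * t ^ 2 := mul_le_mul_of_nonneg_left h (by positivity)
        _ = _ := by ring
    have : 0 ≤ m ^ p * y ^ (2 * p + 2) := by positivity
    linarith
  · have h1 : (t ^ 2) ^ p ≤ (m * y ^ 2) ^ p := pow_le_pow_left₀ (by positivity) h p
    have h2 : 0 ≤ t ^ (2 * p + 2) / m := by positivity
    calc t ^ (2 * p) * y ^ 2 = (t ^ 2) ^ p * y ^ 2 := by ring
      _ ≤ (m * y ^ 2) ^ p * y ^ 2 := mul_le_mul_of_nonneg_right h1 (by positivity)
      _ = m ^ p * y ^ (2 * p + 2) := by rw [mul_pow]; ring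
      _ ≤ _ := by linarith

lemma aux_point (s x m : ℝ) (hm : 1 ≤ m) (p : ℕ) :
    (max (s + x) 0) ^ (2 * p + 2) ≤ (max s 0) ^ (2 * p + 2)
      + (2 * p + 2) * ((max s 0) ^ (2 * p + 1) * x)
      + 2 ^ (2 * p + 2) * ((max s 0) ^ (2 * p + 2) / m + 2 * m ^ p * |x| ^ (2 * p + 2)) := by
  have ht : 0 ≤ max s 0 := le_max_right _ _
  have h1 : max (s + x) 0 ≤ |max s 0 + x| := by
    refine max_le ?_ (abs_nonneg _)
    exact le_trans (by linarith [le_max_left s 0]) (le_abs_self _)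
  have h2 := pow_le_pow_left₀ (le_max_right _ _) h1 (2 * p + 2)
  rw [Even.pow_abs ⟨p + 1, by ring⟩] at h2
  have h3 := aux_binom (max s 0) x ht (2 * p)
  have h4 := aux_young (max s 0) |x| m ht hm p
  have h5 : |x| ^ (2 * p + 2) ≤ m ^ p * |x| ^ (2 * p + 2) :=
    le_mul_of_one_le_left (by positivity) (one_le_pow₀ hm)
  have h6 : (max s 0) ^ (2 * p) * |x| ^ 2 + |x| ^ (2 * p + 2)
      ≤ (max s 0) ^ (2 * p + 2) / m + 2 * m ^ p * |x| ^ (2 * p + 2) := by linarith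
  have h7 := mul_le_mul_of_nonneg_left h6 (show (0:ℝ) ≤ 2 ^ (2 * p + 2) by positivity)
  push_cast at h3
  linarith

lemma aux_rec (A : ℕ → ℝ) (c D : ℝ) (hc : 0 ≤ c) (hD : 0 ≤ D) (h0 : A 0 ≤ 0)
    (h : ∀ k, A (k + 1) ≤ A k * (1 + c) + D) (k : ℕ) : A k ≤ k * D * (1 + c) ^ k := by
  induction k with
  | zero => simpa using h0
  | succ k ih =>
    have h1 : 1 ≤ (1 + c) ^ (k + 1) := one_le_pow₀ (by linarith)
    have h2 := mul_le_mul_of_nonneg_right ih (show 0 ≤ 1 + c by linarith)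
    have h3 := mul_le_mul_of_nonneg_left h1 hD
    have := h k
    push_cast
    calc A (k + 1) ≤ k * D * (1 + c) ^ k * (1 + c) + D * (1 + c) ^ (k + 1) := by linarith
      _ = _ := by ring

theorem stmt0
    {Ω : Type*} [MeasurableSpace Ω] {μ : Measure Ω} [IsProbabilityMeasure μ]
    (ξ : ℕ → Ω → ℝ) (hmeas : ∀ j, Measurable (ξ j))
    (hcond : ∀ j ≥ 1,
      μ[ξ (j + 1) | ⨆ i ∈ Finset.Icc 1 j, MeasurableSpace.comap (ξ i) (borel ℝ)] ≤ᵐ[μ] 0)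
    (hmom : ∀ N : ℕ, 0 < N → ∃ B : ℝ≥0∞, B ≠ ⊤ ∧ ∀ j ≥ 1,
      ∫⁻ ω, ‖ξ j ω‖₊ ^ N ∂μ ≤ B) :
    ∀ ε > (0 : ℝ), ∀ N : ℕ, 0 < N → ∃ κ > (0 : ℝ), ∀ n ≥ 1,
      (μ {ω | ε * n ≤ ∑ j ∈ Finset.Icc 1 n, ξ j ω}).toReal ≤ κ / (n : ℝ) ^ N := by
  intro ε hε N hN
  obtain ⟨p, rfl⟩ : ∃ p, N = p + 1 := ⟨N - 1, by omega⟩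
  obtain ⟨B, hB, hBj⟩ := hmom (2 * p + 2) (by omega)
  set S : ℕ → Ω → ℝ := fun k ω => ∑ j ∈ Finset.Icc 1 k, ξ j ω with hS
  have hSmeas : ∀ k, Measurable (S k) := fun k =>
    Finset.measurable_fun_sum _ fun j _ => hmeas j
  have hlp : ∀ j ≥ 1, MemLp (ξ j) ((2 * p + 2 : ℕ) : ℝ≥0∞) μ := by
    intro j hj
    refine ⟨(hmeas j).aestronglyMeasurable, ?_⟩
    rw [eLpNorm_lt_top_iff_lintegral_rpow_enorm_lt_top (by simp) (ENNReal.natCast_ne_top _)]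
    refine lt_of_le_of_lt (le_of_eq ?_) (lt_of_le_of_lt (hBj j hj) hB.lt_top)
    refine lintegral_congr fun ω => ?_
    rw [ENNReal.toReal_natCast, ENNReal.rpow_natCast]
    simp [enorm]
  have hint : ∀ j ≥ 1, Integrable (fun ω => |ξ j ω| ^ (2 * p + 2)) μ := fun j hj =>
    (hlp j hj).integrable_norm_pow (by omega)
  have hbd : ∀ j ≥ 1, ∫ ω, |ξ j ω| ^ (2 * p + 2) ∂μ ≤ B.toReal := by
    intro j hj
    rw [integral_eq_lintegral_of_nonneg_ae (Filter.Eventually.of_forall fun ω => by positivity)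
      (hint j hj).aestronglyMeasurable]
    refine ENNReal.toReal_mono hB (le_trans (le_of_eq ?_) (hBj j hj))
    refine lintegral_congr fun ω => ?_
    rw [ENNReal.ofReal_pow (abs_nonneg _), ← Real.enorm_eq_ofReal_abs]
    simp [enorm]
  have hSlp : ∀ k, MemLp (S k) ((2 * p + 2 : ℕ) : ℝ≥0∞) μ := fun k =>
    memLp_finsetSum _ fun j hj => hlp j (Finset.mem_Icc.1 hj).1
  have hTmeas : ∀ k, Measurable (fun ω => max (S k ω) 0) := fun k =>
    (hSmeas k).max measurable_const
  have hTint : ∀ k, Integrable (fun ω => (max (S k ω) 0) ^ (2 * p + 2)) μ := by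
    intro k
    refine ((hSlp k).integrable_norm_pow (by omega)).mono'
      ((hTmeas k).pow_const _).aestronglyMeasurable (Filter.Eventually.of_forall fun ω => ?_)
    rw [Real.norm_of_nonneg (by positivity)]
    exact pow_le_pow_left₀ (le_max_right _ _) (max_le (le_abs_self _) (abs_nonneg _)) _
  have hXint : ∀ k, Integrable (fun ω => (max (S k ω) 0) ^ (2 * p + 1) * ξ (k + 1) ω) μ := by
    intro k
    refine ((hTint k).add (hint (k + 1) (by omega))).mono'
      (((hTmeas k).pow_const _).mul (hmeas _)).aestronglyMeasurable
      (Filter.Eventually.of_forall fun ω => ?_)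
    have ht : 0 ≤ max (S k ω) 0 := le_max_right _ _
    have hx := abs_nonneg (ξ (k + 1) ω)
    rw [norm_mul, Real.norm_of_nonneg (by positivity), Real.norm_eq_abs]
    simp only [Pi.add_apply]
    rcases le_total (max (S k ω) 0) |ξ (k + 1) ω| with h | h
    · have h1 := mul_le_mul_of_nonneg_right (pow_le_pow_left₀ ht h (2 * p + 1)) hx
      have h2 : 0 ≤ (max (S k ω) 0) ^ (2 * p + 2) := by positivity
      rw [← pow_succ] at h1
      linarith
    · have h1 := mul_le_mul_of_nonneg_left h (show 0 ≤ (max (S k ω) 0) ^ (2 * p + 1) by positivity)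
      have h2 : 0 ≤ |ξ (k + 1) ω| ^ (2 * p + 2) := by positivity
      rw [← pow_succ] at h1
      linarith
  have hXle : ∀ k, ∫ ω, (max (S k ω) 0) ^ (2 * p + 1) * ξ (k + 1) ω ∂μ ≤ 0 := by
    intro k
    rcases Nat.eq_zero_or_pos k with rfl | hk
    · simp [hS]
    have hle : (⨆ i ∈ Finset.Icc 1 k, MeasurableSpace.comap (ξ i) (borel ℝ)) ≤ ‹MeasurableSpace Ω› := by
      refine iSup₂_le fun i _ => ?_
      rw [← BorelSpace.measurable_eq (α := ℝ)]
      exact (hmeas i).comap_le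
    have hcm := hcond k hk
    set m := (⨆ i ∈ Finset.Icc 1 k, MeasurableSpace.comap (ξ i) (borel ℝ)) with hm
    have hSm : Measurable[m] (S k) := by
      refine Finset.measurable_fun_sum _ fun j hj => ?_
      have h1 : MeasurableSpace.comap (ξ j) (borel ℝ) ≤ m :=
        le_iSup₂_of_le (f := fun i (_ : i ∈ Finset.Icc 1 k) =>
          MeasurableSpace.comap (ξ i) (borel ℝ)) j hj le_rfl
      rw [← BorelSpace.measurable_eq (α := ℝ)] at h1
      exact measurable_iff_comap_le.2 h1
    have hTm : StronglyMeasurable[m] (fun ω => (max (S k ω) 0) ^ (2 * p + 1)) :=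
      ((hSm.max measurable_const).pow_const _).stronglyMeasurable
    have hξi : Integrable (ξ (k + 1)) μ :=
      (hlp (k + 1) (by omega)).integrable (by exact_mod_cast (by omega : 1 ≤ 2 * p + 2))
    have hpull := condExp_mul_of_stronglyMeasurable_left (μ := μ) hTm (hXint k) hξi
    rw [← integral_condExp hle]
    refine integral_nonpos_of_ae ?_
    filter_upwards [hpull, hcm] with ω h1 h2
    refine le_trans (le_of_eq h1) ?_
    exact mul_nonpos_of_nonneg_of_nonpos (pow_nonneg (le_max_right _ _) _) h2
  -- main recursion
  set b := B.toReal with hb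
  have hb0 : 0 ≤ b := ENNReal.toReal_nonneg
  set C : ℝ := 2 ^ (2 * p + 2) with hC
  have hC0 : 0 < C := by positivity
  have hA : ∀ n : ℕ, 1 ≤ n → ∫ ω, (max (S n ω) 0) ^ (2 * p + 2) ∂μ
      ≤ (2 * C * b * Real.exp C) * (n : ℝ) ^ (p + 1) := by
    intro n hn
    have hn1 : (1 : ℝ) ≤ n := by exact_mod_cast hn
    have hn0 : (0 : ℝ) < n := by linarith
    have hrec := aux_rec (fun k => ∫ ω, (max (S k ω) 0) ^ (2 * p + 2) ∂μ) (C / n)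
      (C * (2 * (n : ℝ) ^ p * b)) (by positivity) (by positivity) (by simp [hS]) (by
        intro k
        have i1 : Integrable (fun ω => (2 * (p : ℝ) + 2)
            * ((max (S k ω) 0) ^ (2 * p + 1) * ξ (k + 1) ω)) μ := (hXint k).const_mul _
        have i2 : Integrable (fun ω => (max (S k ω) 0) ^ (2 * p + 2)
            + (2 * (p : ℝ) + 2) * ((max (S k ω) 0) ^ (2 * p + 1) * ξ (k + 1) ω)) μ :=
          (hTint k).add i1
        have i3 : Integrable (fun ω => (max (S k ω) 0) ^ (2 * p + 2) / (n : ℝ)) μ :=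
          (hTint k).div_const _
        have i4 : Integrable (fun ω => 2 * (n : ℝ) ^ p * |ξ (k + 1) ω| ^ (2 * p + 2)) μ :=
          (hint (k + 1) (by omega)).const_mul _
        have i5 : Integrable (fun ω => C * ((max (S k ω) 0) ^ (2 * p + 2) / (n : ℝ)
            + 2 * (n : ℝ) ^ p * |ξ (k + 1) ω| ^ (2 * p + 2))) μ := (i3.add i4).const_mul _
        have hkey : ∫ ω, (max (S (k + 1) ω) 0) ^ (2 * p + 2) ∂μ ≤
            ∫ ω, ((max (S k ω) 0) ^ (2 * p + 2)
              + (2 * p + 2) * ((max (S k ω) 0) ^ (2 * p + 1) * ξ (k + 1) ω)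
              + C * ((max (S k ω) 0) ^ (2 * p + 2) / n
                + 2 * (n : ℝ) ^ p * |ξ (k + 1) ω| ^ (2 * p + 2))) ∂μ := by
          refine integral_mono (hTint _) ?_ fun ω => ?_
          · exact i2.add i5
          · have := aux_point (S k ω) (ξ (k + 1) ω) n hn1 p
            have e : S (k + 1) ω = S k ω + ξ (k + 1) ω := by
              simp only [hS]
              rw [Finset.sum_Icc_succ_top (by omega)]
            simpa only [e] using this
        rw [integral_add i2 i5, integral_add (hTint k) i1, integral_const_mul,
          integral_const_mul, integral_add i3 i4, integral_const_mul, integral_div] at hkey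
        have h1 := hXle k
        have h2 : (2 * (p : ℝ) + 2) * ∫ ω, (max (S k ω) 0) ^ (2 * p + 1) * ξ (k + 1) ω ∂μ ≤ 0 :=
          mul_nonpos_of_nonneg_of_nonpos (by positivity) h1
        have h3 := mul_le_mul_of_nonneg_left (hbd (k + 1) (by omega))
          (show 0 ≤ C * (2 * (n : ℝ) ^ p) by positivity)
        refine hkey.trans ?_
        simp only [mul_add, mul_one]
        have e1 : ∀ a : ℝ, a * (C / n) = C * (a / n) := fun a => by ring
        rw [e1]
        linarith) n
    refine hrec.trans ?_
    have hexp : (1 + C / n) ^ n ≤ Real.exp C := by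
      have h1 : 1 + C / n ≤ Real.exp (C / n) := by linarith [Real.add_one_le_exp (C / n)]
      have h2 := pow_le_pow_left₀ (by positivity) h1 n
      rw [← Real.exp_nat_mul, mul_div_cancel₀ _ hn0.ne'] at h2
      exact h2
    calc _ ≤ (n : ℝ) * (C * (2 * (n : ℝ) ^ p * b)) * Real.exp C :=
          mul_le_mul_of_nonneg_left hexp (by positivity)
      _ = _ := by ring
  refine ⟨(2 * C * b * Real.exp C) / ε ^ (2 * p + 2) + 1, by positivity, fun n hn => ?_⟩
  have hn0 : (0 : ℝ) < n := by exact_mod_cast hn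
  have hmk := mul_meas_ge_le_integral_of_nonneg (μ := μ)
    (f := fun ω => (max (S n ω) 0) ^ (2 * p + 2))
    (Filter.Eventually.of_forall fun ω => pow_nonneg (le_max_right _ _) _) (hTint n)
    ((ε * n) ^ (2 * p + 2))
  have hsub : (μ {ω | ε * n ≤ S n ω}).toReal
      ≤ μ.real {ω | (ε * n) ^ (2 * p + 2) ≤ (max (S n ω) 0) ^ (2 * p + 2)} := by
    refine ENNReal.toReal_mono (measure_ne_top _ _) (measure_mono fun ω hω => ?_)
    have hω' : ε * n ≤ S n ω := hω
    have h0 : 0 ≤ ε * n := by positivity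
    exact pow_le_pow_left₀ h0 (hω'.trans (le_max_left _ _)) (2 * p + 2)
  refine hsub.trans ?_
  have h1 := hmk.trans (hA n hn)
  have hpos : 0 < (ε * n) ^ (2 * p + 2) := by positivity
  rw [← le_div_iff₀' hpos] at h1
  refine h1.trans ?_
  have e : (2 * C * b * Real.exp C) * (n : ℝ) ^ (p + 1) / (ε * n) ^ (2 * p + 2)
      = (2 * C * b * Real.exp C) / ε ^ (2 * p + 2) / (n : ℝ) ^ (p + 1) := by
    rw [mul_pow, show (n : ℝ) ^ (2 * p + 2) = (n : ℝ) ^ (p + 1) * (n : ℝ) ^ (p + 1) by ring]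
    field_simp
  rw [e]
  gcongr
  linarith
end

section
/- Let (ℱ_n)_{n≥0} be a filtration on a probability space, let (T_n)_{n≥0} be a nondecreasing sequence of random variables adapted to (ℱ_n) with T_0 = 0, and let C > 0. Suppose E(T_{n+1} − T_n | ℱ_n) ≤ C almost surely for all n ≥ 0, and for every positive integer N the sequence (E(T_{n+1} − T_n)^N)_n is bounded. Then for every positive integer N there exists κ > 0 such that P(T_n > 2 C n) ≤ κ n^{-N} for all n ≥ 1. -/
open MeasureTheory
open scoped ENNReal

theorem aux_exp (x : ℝ) (h0 : 0 ≤ x) (h1 : x ≤ 1 / 3) : Real.exp x ≤ 1 + 3 / 2 * x := by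
  have h := Real.add_one_le_exp (-x)
  have hm : Real.exp x * Real.exp (-x) = 1 := by rw [← Real.exp_add]; simp
  have hp := Real.exp_pos x
  have h2 : Real.exp x * (1 - x) ≤ 1 := by nlinarith
  by_contra hc
  push Not at hc
  nlinarith

theorem aux_cond {Ω : Type*} {m m0 : MeasurableSpace Ω} {μ : Measure Ω} [IsProbabilityMeasure μ]
    (hm : m ≤ m0) (g X : Ω → ℝ) (hg : Measurable[m] g) (hg0 : ∀ ω, 0 ≤ g ω) (K : ℝ)
    (hgK : ∀ ω, g ω ≤ K) (hX : Integrable X μ) (C : ℝ)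
    (hc : ∀ᵐ ω ∂μ, (μ[X | m]) ω ≤ C) :
    Integrable (fun ω => g ω * X ω) μ ∧ ∫ ω, g ω * X ω ∂μ ≤ C * ∫ ω, g ω ∂μ := by
  have hbd : ∀ᵐ ω ∂μ, ‖g ω‖ ≤ K := by
    filter_upwards with ω
    rw [Real.norm_of_nonneg (hg0 ω)]; exact hgK ω
  have hgm : AEStronglyMeasurable g μ := (hg.mono hm le_rfl).aestronglyMeasurable
  have hi : Integrable (fun ω => g ω * X ω) μ := hX.bdd_mul hgm hbd
  have hgi : Integrable g μ := Integrable.of_bound hgm K hbd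
  refine ⟨hi, ?_⟩
  have h1 : μ[fun ω => g ω * X ω | m] =ᵐ[μ] fun ω => g ω * (μ[X|m]) ω :=
    condExp_mul_of_stronglyMeasurable_left (m := m) hg.stronglyMeasurable hi hX
  rw [← integral_condExp hm, integral_congr_ae h1, ← integral_const_mul]
  apply integral_mono_ae
  · exact integrable_condExp.bdd_mul hgm hbd
  · exact hgi.const_mul C
  · filter_upwards [hc] with ω hω
    nlinarith [hg0 ω]

theorem aux_mgf {Ω : Type*} {m0 : MeasurableSpace Ω} {μ : Measure Ω} [IsProbabilityMeasure μ]
    (ℱ : Filtration ℕ m0) (X : ℕ → Ω → ℝ)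
    (hX : ∀ n, Measurable[ℱ (n + 1)] (X n)) (hX0 : ∀ n ω, 0 ≤ X n ω)
    (hXi : ∀ n, Integrable (X n) μ) (C : ℝ) (hC : 0 < C)
    (hc : ∀ n, ∀ᵐ ω ∂μ, (μ[X n | ℱ n]) ω ≤ C) (A l : ℝ) (hA : 0 < A) (hl : 0 < l)
    (hlA : l * A = 1 / 3) (n : ℕ) :
    Integrable (fun ω => Real.exp (l * ∑ i ∈ Finset.range n, min (X i ω) A)) μ ∧
    ∫ ω, Real.exp (l * ∑ i ∈ Finset.range n, min (X i ω) A) ∂μ ≤ Real.exp (3 / 2 * l * C * n) := by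
  have hmeas : ∀ n, Measurable[ℱ n]
      (fun ω => Real.exp (l * ∑ i ∈ Finset.range n, min (X i ω) A)) := by
    intro n
    refine Real.measurable_exp.comp (Measurable.const_mul ?_ l)
    refine Finset.measurable_fun_sum _ fun i hi => ?_
    have : Measurable[ℱ n] (X i) := (hX i).mono (ℱ.mono (by simp at hi; omega)) le_rfl
    exact this.min measurable_const
  have hbd : ∀ n ω, Real.exp (l * ∑ i ∈ Finset.range n, min (X i ω) A) ≤ Real.exp (l * (n * A)) := by
    intro n ω
    apply Real.exp_le_exp.2
    apply mul_le_mul_of_nonneg_left _ hl.le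
    calc _ ≤ ∑ i ∈ Finset.range n, A := Finset.sum_le_sum fun i _ => min_le_right _ _
      _ = _ := by simp
  have hint : ∀ n, Integrable (fun ω => Real.exp (l * ∑ i ∈ Finset.range n, min (X i ω) A)) μ := by
    intro n
    refine Integrable.of_bound ((hmeas n).mono (ℱ.le n) le_rfl).aestronglyMeasurable
      (Real.exp (l * (n * A))) ?_
    filter_upwards with ω
    rw [Real.norm_of_nonneg (Real.exp_pos _).le]; exact hbd n ω
  refine ⟨hint n, ?_⟩
  induction n with
  | zero => simp
  | succ n ih =>
    obtain ⟨h1, h2⟩ := aux_cond (ℱ.le n) _ (X n) (hmeas n) (fun ω => (Real.exp_pos _).le) _ (hbd n)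
      (hXi n) C (hc n)
    set g := (fun ω => Real.exp (l * ∑ i ∈ Finset.range n, min (X i ω) A)) with hg
    calc _ ≤ ∫ ω, (g ω + 3 / 2 * l * (g ω * X n ω)) ∂μ := by
          apply integral_mono (hint (n+1)) ((hint n).add (h1.const_mul _))
          intro ω
          simp only [Finset.sum_range_succ, mul_add, Real.exp_add]
          have ha := aux_exp (l * min (X n ω) A) (mul_nonneg hl.le (le_min (hX0 n ω) hA.le))
            (by rw [← hlA]; exact mul_le_mul_of_nonneg_left (min_le_right _ _) hl.le)
          have hb : l * min (X n ω) A ≤ l * X n ω :=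
            mul_le_mul_of_nonneg_left (min_le_left _ _) hl.le
          have hp : 0 < g ω := Real.exp_pos _
          have : g ω * Real.exp (l * min (X n ω) A) ≤ g ω * (1 + 3 / 2 * (l * X n ω)) :=
            mul_le_mul_of_nonneg_left (by linarith) hp.le
          calc _ ≤ _ := this
            _ = _ := by simp only [Pi.add_apply, hg]; ring
      _ = ∫ ω, g ω ∂μ + 3 / 2 * l * ∫ ω, g ω * X n ω ∂μ := by
          rw [integral_add (hint n) (h1.const_mul _), integral_const_mul]
      _ ≤ ∫ ω, g ω ∂μ + 3 / 2 * l * (C * ∫ ω, g ω ∂μ) := by gcongr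
      _ = (3 / 2 * l * C + 1) * ∫ ω, g ω ∂μ := by ring
      _ ≤ Real.exp (3 / 2 * l * C) * Real.exp (3 / 2 * l * C * n) := by
          apply mul_le_mul (Real.add_one_le_exp _) ih
            (integral_nonneg fun ω => (Real.exp_pos _).le) (Real.exp_pos _).le
      _ = _ := by rw [← Real.exp_add]; push_cast; ring_nf

/-- Let (T_n) be a nondecreasing adapted process with T_0 = 0, such that
E(T_{n+1} − T_n | ℱ_n) ≤ C a.s. for all n, and for every positive integer N the sequence
(E(T_{n+1} − T_n)^N)_n is bounded. Then for every positive integer N there is κ > 0 with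
P(T_n > 2 C n) ≤ κ n^{-N} for all n ≥ 1. -/
theorem stmt13
    {Ω : Type*} {m0 : MeasurableSpace Ω} {μ : Measure Ω} [IsProbabilityMeasure μ]
    (ℱ : Filtration ℕ m0) (T : ℕ → Ω → ℝ)
    (hadapted : Adapted ℱ T)
    (hmono : ∀ ω, Monotone fun n => T n ω) (hT0 : T 0 = 0)
    (C : ℝ) (hC : 0 < C)
    (hdrift : ∀ n : ℕ, ∀ᵐ ω ∂μ, (μ[fun ω' => T (n + 1) ω' - T n ω' | ℱ n]) ω ≤ C)
    (hmom : ∀ N : ℕ, 0 < N → ∃ B : ℝ, ∀ n : ℕ,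
      ∫⁻ ω, ‖T (n + 1) ω - T n ω‖₊ ^ N ∂μ ≤ ENNReal.ofReal B) :
    ∀ N : ℕ, 0 < N → ∃ κ > (0 : ℝ), ∀ n : ℕ, 1 ≤ n →
      μ {ω | 2 * C * n < T n ω} ≤ ENNReal.ofReal (κ / (n : ℝ) ^ N) := by
  intro N hN
  obtain ⟨B, hB⟩ := hmom (2 * (N + 1)) (by omega)
  obtain ⟨B1, hB1⟩ := hmom 1 one_pos
  set X : ℕ → Ω → ℝ := fun n ω => T (n + 1) ω - T n ω with hXdef
  have hX : ∀ n, Measurable[ℱ (n + 1)] (X n) := fun n =>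
    (hadapted (n + 1)).sub ((hadapted n).mono (ℱ.mono (Nat.le_succ n)) le_rfl)
  have hX0 : ∀ n ω, 0 ≤ X n ω := fun n ω => sub_nonneg.2 (hmono ω (Nat.le_succ n))
  have hXi : ∀ n, Integrable (X n) μ := by
    intro n
    refine ⟨((hX n).mono (ℱ.le _) le_rfl).aestronglyMeasurable, ?_⟩
    refine lt_of_le_of_lt ?_ (lt_of_le_of_lt (hB1 n) ENNReal.ofReal_lt_top)
    simp [enorm, hXdef]
  have hTsum : ∀ n ω, T n ω = ∑ i ∈ Finset.range n, X i ω := by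
    intro n ω
    rw [Finset.sum_range_sub (fun i => T i ω), hT0]; simp
  have hBmax : (0:ℝ) ≤ max B 0 := le_max_right _ _
  have hc6 : (0:ℝ) < (2 * N).factorial / (C / 6) ^ (2 * N) := by positivity
  refine ⟨max B 0 + (2 * N).factorial / (C / 6) ^ (2 * N), by linarith, fun n hn => ?_⟩
  have hn0 : (0:ℝ) < n := by exact_mod_cast hn
  set A := √(n:ℝ) with hAdef
  have hA : 0 < A := Real.sqrt_pos.2 hn0
  have hAA : A ^ 2 = n := Real.sq_sqrt hn0.le
  set l := 1 / (3 * A) with hl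
  have hl0 : 0 < l := by positivity
  have hlA : l * A = 1 / 3 := by rw [hl]; field_simp
  obtain ⟨hei, hele⟩ := aux_mgf (μ := μ) ℱ X hX hX0 hXi C hC hdrift A l hA hl0 hlA n
  -- Chernoff
  have hch : μ {ω | 2 * C * n ≤ ∑ i ∈ Finset.range n, min (X i ω) A} ≤
      ENNReal.ofReal ((2 * N).factorial / (C / 6) ^ (2 * N) / (n : ℝ) ^ N) := by
    have h := ProbabilityTheory.measure_ge_le_exp_mul_mgf (μ := μ)
      (X := fun ω => ∑ i ∈ Finset.range n, min (X i ω) A) (2 * C * n) hl0.le hei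
    rw [← ofReal_measureReal]
    apply ENNReal.ofReal_le_ofReal
    refine h.trans ?_
    have hln : l * n = A / 3 := by rw [← hAA, hl]; field_simp
    calc _ ≤ Real.exp (-l * (2 * C * n)) * Real.exp (3 / 2 * l * C * n) :=
          mul_le_mul_of_nonneg_left hele (Real.exp_pos _).le
      _ = Real.exp (-(C / 6 * A)) := by
          rw [← Real.exp_add]; congr 1; linear_combination (-(C / 2)) * hln
      _ = (Real.exp (C / 6 * A))⁻¹ := Real.exp_neg _
      _ ≤ ((C / 6 * A) ^ (2 * N) / (2 * N).factorial)⁻¹ :=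
          inv_anti₀ (by positivity) (Real.pow_div_factorial_le_exp _ (by positivity) _)
      _ = _ := by
          rw [mul_pow, pow_mul A, hAA, inv_div, div_div]
  -- Markov
  have hmk : ∀ i, μ {ω | A ≤ X i ω} ≤ ENNReal.ofReal (max B 0 / (n : ℝ) ^ (N + 1)) := by
    intro i
    have hmeas : Measurable (X i) := (hX i).mono (ℱ.le _) le_rfl
    have h := meas_ge_le_lintegral_div (μ := μ)
      (f := fun ω => ENNReal.ofReal (X i ω ^ (2 * (N + 1))))
      (hmeas.pow_const _).ennreal_ofReal.aemeasurable (ε := ENNReal.ofReal ((n:ℝ) ^ (N + 1)))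
      (by simp; positivity) ENNReal.ofReal_ne_top
    refine (measure_mono ?_).trans (h.trans ?_)
    · intro ω hω
      apply ENNReal.ofReal_le_ofReal
      rw [← hAA, ← pow_mul]
      exact pow_le_pow_left₀ hA.le hω _
    · rw [ENNReal.ofReal_div_of_pos (by positivity)]
      gcongr
      refine le_trans (le_of_eq ?_) ((hB i).trans (ENNReal.ofReal_le_ofReal (le_max_left _ _)))
      congr 1; ext ω
      rw [ENNReal.ofReal_pow (hX0 i ω), ← Real.enorm_of_nonneg (hX0 i ω)]
      simp [enorm, hXdef]
  calc μ {ω | 2 * C * n < T n ω}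
      ≤ μ ((⋃ i ∈ Finset.range n, {ω | A ≤ X i ω}) ∪
        {ω | 2 * C * n ≤ ∑ i ∈ Finset.range n, min (X i ω) A}) := by
        apply measure_mono
        intro ω hω
        by_cases hb : ∃ i ∈ Finset.range n, A ≤ X i ω
        · left
          obtain ⟨i, hi, hi'⟩ := hb
          exact Set.mem_biUnion hi hi'
        · right
          push Not at hb
          have : ∑ i ∈ Finset.range n, min (X i ω) A = T n ω := by
            rw [hTsum]
            exact Finset.sum_congr rfl fun i hi => min_eq_left (hb i hi).le
          simp only [Set.mem_ofPred_eq] at hω ⊢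
          rw [this]; exact hω.le
    _ ≤ ∑ i ∈ Finset.range n, μ {ω | A ≤ X i ω} + _ :=
        (measure_union_le _ _).trans (by gcongr; exact measure_biUnion_finset_le _ _)
    _ ≤ ∑ i ∈ Finset.range n, ENNReal.ofReal (max B 0 / (n : ℝ) ^ (N + 1)) +
        ENNReal.ofReal ((2 * N).factorial / (C / 6) ^ (2 * N) / (n : ℝ) ^ N) := by
        gcongr with i hi
        exact hmk i
    _ = _ := by
        rw [← ENNReal.ofReal_sum_of_nonneg (fun _ _ => by positivity),
          ← ENNReal.ofReal_add (Finset.sum_nonneg fun _ _ => by positivity) (by positivity)]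
        congr 1
        rw [Finset.sum_const, Finset.card_range, nsmul_eq_mul, add_div]
        congr 1
        rw [pow_succ]; field_simp
end
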